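/- Let 1 ≤ p < ∞, let (X,𝒜,μ) be a probability space, let S,T : X → X be commuting, invertible, measure-preserving, ergodic transformations, and let {R_n}_{n∈ℕ} be a process. Then the following are equivalent: (i) for every f ∈ L^p(X), M*f(x) < ∞ for almost every x ∈ X; (ii) the maximal operator M* is of weak-type (p,p). -/

import Mathlib

open MeasureTheory Filter Topology Set
open scoped ENNReal Pointwise BigOperators

noncomputable section

/-- A (possibly tilted) closed rectangle in the plane, described by a corner,
an angle, and two positive side lengths. -/
structure Rect where
  corner : ℝ × ℝ
  angle : ℝ
  len1 : ℝ
  len2 : ℝ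
  len1_pos : 0 < len1
  len2_pos : 0 < len2

namespace Rect

/-- The set of points of a rectangle. -/
def carrier (R : Rect) : Set (ℝ × ℝ) :=
  {p | ∃ s t : ℝ, s ∈ Icc (0 : ℝ) R.len1 ∧ t ∈ Icc (0 : ℝ) R.len2 ∧
    p = R.corner + s • (Real.cos R.angle, Real.sin R.angle) +
      t • (-Real.sin R.angle, Real.cos R.angle)}

/-- `l(R)`: the length of the shortest side. -/
def shortSide (R : Rect) : ℝ := min R.len1 R.len2

/-- `L(R)`: the length of the longest side. -/
def longSide (R : Rect) : ℝ := max R.len1 R.len2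

/-- The slope of a rectangle: the tangent of the angle formed between its longest
side and the horizontal axis (canonical choice for squares). -/
def slope (R : Rect) : ℝ :=
  if R.len2 ≤ R.len1 then Real.tan R.angle else Real.tan (R.angle + Real.pi / 2)

end Rect

/-- The integer lattice points lying in a planar set. -/
def latticePts (F : Set (ℝ × ℝ)) : Set (ℤ × ℤ) := {p | ((p.1 : ℝ), (p.2 : ℝ)) ∈ F}

/-- `#(F ∩ ℤ²)`: the number of integer lattice points in `F`. -/
def latticeCount (F : Set (ℝ × ℝ)) : ℕ := (latticePts F).ncard

/-- A process: a sequence of rectangles containing `(0,0)` whose shortest sides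
tend to infinity. -/
def IsProcess (R : ℕ → Rect) : Prop :=
  (∀ n, ((0 : ℝ), (0 : ℝ)) ∈ (R n).carrier) ∧
    Tendsto (fun n => (R n).shortSide) atTop atTop

variable {X : Type*} [MeasurableSpace X]

/-- The ergodic average `M_R f(x) = (1/#(R ∩ ℤ²)) ∑_{(i,j) ∈ R ∩ ℤ²} f(S^i T^j x)`. -/
def ergAvg (S T : X ≃ᵐ X) (R : Rect) (f : X → ℝ) (x : X) : ℝ :=
  (latticeCount R.carrier : ℝ)⁻¹ *
    ∑ᶠ p ∈ latticePts R.carrier, f ((S.toEquiv ^ p.1) ((T.toEquiv ^ p.2) x))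

/-- The maximal operator `M* f = sup_n M_n |f|`. -/
def maxOp (S T : X ≃ᵐ X) (R : ℕ → Rect) (f : X → ℝ) (x : X) : ℝ≥0∞ :=
  ⨆ n, ENNReal.ofReal (ergAvg S T (R n) (fun y => |f y|) x)

/-- The maximal operator `M'* f = sup_n |M_n f|`. -/
def maxOpAbs (S T : X ≃ᵐ X) (R : ℕ → Rect) (f : X → ℝ) (x : X) : ℝ≥0∞ :=
  ⨆ n, ENNReal.ofReal |ergAvg S T (R n) f x|

/-- `S, T` form a pair of commuting, invertible, measure-preserving, ergodic
transformations of the probability space `(X, μ)`. -/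
structure ErgodicSetup (μ : Measure X) (S T : X ≃ᵐ X) : Prop where
  prob : IsProbabilityMeasure μ
  measPres_S : MeasurePreserving (⇑S) μ μ
  measPres_T : MeasurePreserving (⇑T) μ μ
  comm : ∀ x, S (T x) = T (S x)
  erg_S : Ergodic (⇑S) μ
  erg_T : Ergodic (⇑T) μ

/-- An operator `M` is of weak-type `(p,p)`. -/
def IsWeakType (μ : Measure X) (M : (X → ℝ) → X → ℝ≥0∞) (p : ℝ) : Prop :=
  ∃ C : ℝ, 0 < C ∧ ∀ f : X → ℝ, MemLp f (ENNReal.ofReal p) μ → ∀ lam : ℝ, 0 < lam →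
    μ {x | ENNReal.ofReal lam < M f x} ≤
      ENNReal.ofReal (C * ((eLpNorm f (ENNReal.ofReal p) μ).toReal / lam) ^ p)

/-- The averages `M_n f` converge almost everywhere. -/
def AEConverges (μ : Measure X) (S T : X ≃ᵐ X) (R : ℕ → Rect) (f : X → ℝ) : Prop :=
  ∀ᵐ x ∂μ, ∃ L : ℝ, Tendsto (fun n => ergAvg S T (R n) f x) atTop (𝓝 L)

/-- The maximal operator `M*` satisfies a Tauberian condition. -/
def ErgTauberian (μ : Measure X) (S T : X ≃ᵐ X) (R : ℕ → Rect) : Prop :=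
  ∀ lam : ℝ, 0 < lam → lam < 1 → ∃ C : ℝ, 0 < C ∧ ∀ A : Set X, MeasurableSet A →
    0 < μ A → μ A < ⊤ →
    μ {x | ENNReal.ofReal lam < maxOp S T R (A.indicator fun _ => (1 : ℝ)) x} ≤
      ENNReal.ofReal C * μ A

/-- A `p`-good process: on every probability space with a commuting, invertible,
measure-preserving, ergodic pair, the averages converge a.e. for every `f ∈ L^p`. -/
def IsGoodProcess (R : ℕ → Rect) (p : ℝ≥0∞) : Prop :=
  ∀ (Y : Type) [MeasurableSpace Y], ∀ (μ : Measure Y) (S T : Y ≃ᵐ Y),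
    ErgodicSetup μ S T → ∀ f : Y → ℝ, MemLp f p μ → AEConverges μ S T R f

/-- The discrete average `A_R φ(k,l)`. -/
def discAvg (R : Rect) (φ : ℤ × ℤ → ℝ) (kl : ℤ × ℤ) : ℝ :=
  (latticeCount R.carrier : ℝ)⁻¹ *
    ∑ᶠ p ∈ latticePts R.carrier, φ (kl.1 + p.1, kl.2 + p.2)

/-- The discrete maximal operator `A* φ = sup_n A_n |φ|`. -/
def discMaxOp (R : ℕ → Rect) (φ : ℤ × ℤ → ℝ) (kl : ℤ × ℤ) : ℝ≥0∞ :=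
  ⨆ n, ENNReal.ofReal (discAvg (R n) (fun q => |φ q|) kl)

/-- The `N`-truncated discrete maximal operator `A*_N φ = sup_{n ≥ N} A_n |φ|`. -/
def discMaxOpFrom (R : ℕ → Rect) (N : ℕ) (φ : ℤ × ℤ → ℝ) (kl : ℤ × ℤ) : ℝ≥0∞ :=
  ⨆ n, ⨆ (_ : N ≤ n), ENNReal.ofReal (discAvg (R n) (fun q => |φ q|) kl)

def lpSum (φ : ℤ × ℤ → ℝ) (p : ℝ) : ℝ≥0∞ := ∑' q : ℤ × ℤ, ENNReal.ofReal (|φ q| ^ p)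

/-- `φ ∈ ℓ^p(ℤ²)`. -/
def Memlp (φ : ℤ × ℤ → ℝ) (p : ℝ) : Prop := lpSum φ p < ⊤

/-- The `ℓ^p(ℤ²)` norm. -/
def lpNorm (φ : ℤ × ℤ → ℝ) (p : ℝ) : ℝ≥0∞ := lpSum φ p ^ (1 / p)

/-- The `ℓ^p(ℤ²)` norm of an `ℝ≥0∞`-valued function. -/
def lpNormE (F : ℤ × ℤ → ℝ≥0∞) (p : ℝ) : ℝ≥0∞ := (∑' q : ℤ × ℤ, F q ^ p) ^ (1 / p)

/-- A discrete operator `B` is of weak-type `(p,p)` on `ℓ^p(ℤ²)`. -/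
def IsDiscWeakType (B : (ℤ × ℤ → ℝ) → ℤ × ℤ → ℝ≥0∞) (p : ℝ) : Prop :=
  ∃ C : ℝ, 0 < C ∧ ∀ φ : ℤ × ℤ → ℝ, Memlp φ p → ∀ lam : ℝ, 0 < lam →
    Measure.count {kl : ℤ × ℤ | ENNReal.ofReal lam ≤ B φ kl} ≤
      ENNReal.ofReal (C * ((lpNorm φ p).toReal / lam) ^ p)

/-- The discrete maximal operator associated with `R` satisfies a Tauberian condition. -/
def DiscTauberian (R : ℕ → Rect) : Prop :=
  ∀ lam : ℝ, 0 < lam → ∃ C : ℝ, 0 < C ∧ ∀ E : Finset (ℤ × ℤ), E.Nonempty →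
    Measure.count {kl : ℤ × ℤ |
        ENNReal.ofReal lam ≤ discMaxOp R (fun q => if q ∈ E then (1 : ℝ) else 0) kl} ≤
      ENNReal.ofReal C * (E.card : ℝ≥0∞)

/-- Vertices and sets of the geometric construction 1 (with `A = (1,0)`,
`B = (0,b)`, `C = (0,c)`). -/
def ptA : ℝ × ℝ := (1, 0)
def ptB (b : ℝ) : ℝ × ℝ := (0, b)
def ptC (c : ℝ) : ℝ × ℝ := (0, c)
def ptB' (b : ℝ) : ℝ × ℝ := ptA + (3 / 2 : ℝ) • (ptB b - ptA)
def ptC' (c : ℝ) : ℝ × ℝ := ptA + (3 / 2 : ℝ) • (ptC c - ptA)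

/-- The full triangle `ABC`. -/
def triABC (b c : ℝ) : Set (ℝ × ℝ) := convexHull ℝ {ptA, ptB b, ptC c}

/-- The full trapezium `BCC'B'`. -/
def trapV (b c : ℝ) : Set (ℝ × ℝ) := convexHull ℝ {ptB b, ptC c, ptC' c, ptB' b}

/-- The rectangle `P`: the smallest rectangle having `AC'` as one of its sides and
containing the triangle `AB'C'`, translated so that its center is the origin.
Its sides have directions `(-1,c)/√(1+c²)` and `(c,1)/√(1+c²)`, with half-lengths
`(3/4)√(1+c²)` and `(3/4)(b-c)/√(1+c²)`. -/
def rectP (b c : ℝ) : Set (ℝ × ℝ) :=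
  {p : ℝ × ℝ |
    |(-p.1 + c * p.2)| / Real.sqrt (1 + c ^ 2) ≤ (3 / 4) * Real.sqrt (1 + c ^ 2) ∧
    |(c * p.1 + p.2)| / Real.sqrt (1 + c ^ 2) ≤ (3 / 4) * (b - c) / Real.sqrt (1 + c ^ 2)}

/-- Horizontal translation of a planar set by `t`. -/
def hTranslate (t : ℝ) (F : Set (ℝ × ℝ)) : Set (ℝ × ℝ) :=
  (fun p : ℝ × ℝ => (p.1 + t, p.2)) '' F

/-- The triangle `Δ_k` with vertices `A = (0,1)`, `B_{k-1} = (u_{k-1}, 0)`,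
`B_k = (u_k, 0)`. -/
def triPerron (u : ℕ → ℝ) (k : ℕ) : Set (ℝ × ℝ) :=
  convexHull ℝ {((0 : ℝ), (1 : ℝ)), ((u (k - 1) : ℝ), (0 : ℝ)), ((u k : ℝ), (0 : ℝ))}

/-- The symmetric difference `Δ_n := R_n △ (R_n + (0,1))`. -/
def symmDiffTranslate (R : Rect) : Set (ℝ × ℝ) :=
  symmDiff R.carrier ((fun q : ℝ × ℝ => q + ((0 : ℝ), (1 : ℝ))) '' R.carrier)



theorem aux_iter_ind {X : Type*} [MeasurableSpace X] {μ : Measure X} [IsProbabilityMeasure μ]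
    {S : X → X} (hS : MeasurePreserving S μ μ) {A B : Set X} (hA : MeasurableSet A) (hB : MeasurableSet B) (k : ℕ) :
    inner ℝ (indicatorConstLp 2 hA (measure_ne_top μ A) (1:ℝ))
      (((Lp.compMeasurePreservingₗᵢ ℝ S hS).toContinuousLinearMap : Lp ℝ 2 μ →L[ℝ] Lp ℝ 2 μ)^[k]
        (indicatorConstLp 2 hB (measure_ne_top μ B) (1:ℝ))) = μ.real (A ∩ S^[k] ⁻¹' B) := by
  have h1 : ((Lp.compMeasurePreservingₗᵢ ℝ S hS).toContinuousLinearMap : Lp ℝ 2 μ →L[ℝ] Lp ℝ 2 μ)^[k]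
        (indicatorConstLp 2 hB (measure_ne_top μ B) (1:ℝ)) =
        Lp.compMeasurePreserving (S^[k]) (hS.iterate k) (indicatorConstLp 2 hB (measure_ne_top μ B) (1:ℝ)) := by
    rw [← Lp.compMeasurePreserving_iterate]
    rfl
  rw [h1, Lp.indicatorConstLp_compMeasurePreserving hB (measure_ne_top μ B) (1:ℝ) (hS.iterate k),
    L2.inner_indicatorConstLp_one hA (measure_ne_top μ A)]
  rw [setIntegral_indicatorConstLp hA ((hS.iterate k).measurable hB)]
  simp [inter_comm]

theorem aux_mix {X : Type*} [MeasurableSpace X] {μ : Measure X} [IsProbabilityMeasure μ]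
    {S : X → X} (hS : Ergodic S μ) {A B : Set X} (hA : MeasurableSet A) (hB : MeasurableSet B) :
    ∃ m : ℕ, μ.real A * μ.real B / 2 ≤ μ.real (A ∩ S^[m] ⁻¹' B) := by
  by_contra! hcon
  have hpos : 0 < μ.real A * μ.real B := by
    have := hcon 0
    have h2 : 0 ≤ μ.real (A ∩ S^[0] ⁻¹' B) := measureReal_nonneg
    linarith
  have hmp := hS.toMeasurePreserving
  set U : Lp ℝ 2 μ →L[ℝ] Lp ℝ 2 μ := (Lp.compMeasurePreservingₗᵢ ℝ S hmp).toContinuousLinearMap with hU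
  set v : Lp ℝ 2 μ := indicatorConstLp 2 hB (measure_ne_top μ B) (1:ℝ) with hv
  have hlim := U.tendsto_birkhoffAverage_orthogonalProjection
    (LinearIsometry.norm_toContinuousLinearMap_le _) v
  set P := (U.eqLocus (1 : Lp ℝ 2 μ →L[ℝ] Lp ℝ 2 μ)).orthogonalProjectionOnto v with hP
  have hfix : U (P : Lp ℝ 2 μ) = P := P.2
  have hc : ∃ c : ℝ, (P : Lp ℝ 2 μ) =ᵐ[μ] fun _ => c := by
    refine hS.ae_eq_const_of_ae_eq_comp_ae (Lp.aestronglyMeasurable _) ?_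
    have h := Lp.coeFn_compMeasurePreserving (P : Lp ℝ 2 μ) hmp
    have h' : Lp.compMeasurePreserving S hmp (P : Lp ℝ 2 μ) = P := hfix
    rw [h'] at h
    exact h.symm
  obtain ⟨c, hc⟩ := hc
  have key : ∀ (D : Set X) (hD : MeasurableSet D),
      Tendsto (fun n : ℕ => (n:ℝ)⁻¹ * ∑ k ∈ Finset.range n, μ.real (D ∩ S^[k] ⁻¹' B)) atTop
        (𝓝 (c * μ.real D)) := by
    intro D hD
    have h1 := (tendsto_const_nhds (x := indicatorConstLp 2 hD (measure_ne_top μ D) (1:ℝ))).inner (𝕜 := ℝ) hlim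
    have h2 : inner ℝ (indicatorConstLp 2 hD (measure_ne_top μ D) (1:ℝ)) (P : Lp ℝ 2 μ) = c * μ.real D := by
      rw [L2.inner_indicatorConstLp_one hD (measure_ne_top μ D)]
      rw [setIntegral_congr_ae (g := fun _ => c) hD (hc.mono fun x hx _ => hx)]
      simp [mul_comm]
    rw [h2] at h1
    refine h1.congr fun n => ?_
    simp only [birkhoffAverage, birkhoffSum, inner_smul_right, inner_sum, id]
    congr 1
    exact Finset.sum_congr rfl fun k _ => aux_iter_ind hmp hD hB k
  have hcB : c = μ.real B := by
    have h1 := key univ MeasurableSet.univ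
    have h2 : Tendsto (fun n : ℕ => (n:ℝ)⁻¹ * ∑ k ∈ Finset.range n, μ.real (univ ∩ S^[k] ⁻¹' B)) atTop
        (𝓝 (μ.real B)) := by
      refine tendsto_const_nhds.congr' ?_
      filter_upwards [eventually_gt_atTop 0] with n hn
      have : ∀ k, μ.real (univ ∩ S^[k] ⁻¹' B) = μ.real B := fun k => by
        rw [univ_inter, (hmp.iterate k).measureReal_preimage hB.nullMeasurableSet]
      have hn' : (n:ℝ) ≠ 0 := by positivity
      simp only [this, Finset.sum_const, Finset.card_range, nsmul_eq_mul]
      field_simp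
    have := tendsto_nhds_unique h1 h2
    simpa using this
  have hle : c * μ.real A ≤ μ.real A * μ.real B / 2 := by
    refine le_of_tendsto (key A hA) ?_
    filter_upwards [eventually_gt_atTop 0] with n hn
    have hn' : (0:ℝ) < n := by positivity
    rw [inv_mul_le_iff₀ hn']
    calc _ ≤ ∑ k ∈ Finset.range n, μ.real A * μ.real B / 2 :=
          Finset.sum_le_sum fun k _ => (hcon k).le
      _ = _ := by simp
  rw [hcB] at hle
  nlinarith

theorem aux_cover {X : Type*} [MeasurableSpace X] {μ : Measure X} [IsProbabilityMeasure μ]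
    {S : X → X} (hS : Ergodic S μ) {B : Set X} (hB : MeasurableSet B) (N : ℕ) :
    ∃ m : ℕ → ℕ, μ.real (⋃ i ∈ Finset.range N, S^[m i] ⁻¹' B)ᶜ ≤ (1 - μ.real B / 2) ^ N := by
  induction N with
  | zero => exact ⟨0, by simp⟩
  | succ N ih =>
    obtain ⟨m, hm⟩ := ih
    set A := (⋃ i ∈ Finset.range N, S^[m i] ⁻¹' B)ᶜ with hAdef
    have hA : MeasurableSet A :=
      (Finset.measurableSet_biUnion _ fun i _ => (hS.toMeasurePreserving.iterate (m i)).measurable hB).compl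
    obtain ⟨k, hk⟩ := aux_mix hS hA hB
    refine ⟨Function.update m N k, ?_⟩
    have h1 : (⋃ i ∈ Finset.range (N+1), S^[Function.update m N k i] ⁻¹' B)ᶜ = A \ (A ∩ S^[k] ⁻¹' B) := by
      rw [sdiff_self_inter, sdiff_eq, hAdef, ← compl_union]
      congr 1
      rw [Finset.range_add_one, Finset.set_biUnion_insert, union_comm]
      congr 1
      · refine iUnion₂_congr fun i hi => ?_
        rw [Function.update_of_ne (Finset.mem_range.1 hi).ne]
      · simp
    rw [h1, measureReal_sdiff inter_subset_left (hA.inter ((hS.toMeasurePreserving.iterate k).measurable hB))]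
    have hb : μ.real B ≤ 1 := measureReal_le_one
    have : μ.real A * (1 - μ.real B / 2) ≤ (1 - μ.real B / 2) ^ N * (1 - μ.real B / 2) :=
      mul_le_mul_of_nonneg_right hm (by linarith)
    rw [pow_succ]
    linarith

theorem aux_sup {X : Type*} [MeasurableSpace X] {μ : Measure X} {ι : Type*} [Countable ι] {p : ℝ} (hp : 0 < p)
    (h : ι → X → ℝ≥0∞) (hm : ∀ i, Measurable (h i)) :
    ∫⁻ x, (⨆ i, h i x) ^ p ∂μ ≤ ∑' i, ∫⁻ x, (h i x) ^ p ∂μ := by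
  rw [← lintegral_tsum fun i => ((hm i).pow_const p).aemeasurable]
  refine lintegral_mono fun x => ?_
  rw [← ENNReal.le_rpow_inv_iff hp]
  refine iSup_le fun i => ?_
  rw [ENNReal.le_rpow_inv_iff hp]
  exact ENNReal.le_tsum (f := fun i => h i x ^ p) i

theorem aux_comm {X : Type*} {S : X → X} {M : (X → ℝ≥0∞) → X → ℝ≥0∞}
    (hcomm : ∀ g x, M (fun y => g (S y)) x = M g (S x)) (m : ℕ) (g : X → ℝ≥0∞) (x : X) :
    M (fun y => g (S^[m] y)) x = M g (S^[m] x) := by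
  induction m generalizing g x with
  | zero => rfl
  | succ m ih =>
    simp only [Function.iterate_succ_apply]
    rw [hcomm (fun y => g (S^[m] y)) x, ih]

theorem aux_step1 {X : Type*} [MeasurableSpace X] {μ : Measure X} [IsProbabilityMeasure μ]
    {M : (X → ℝ≥0∞) → X → ℝ≥0∞} {p : ℝ} (hp : 0 < p)
    (hmono : ∀ g h : X → ℝ≥0∞, (∀ x, g x ≤ h x) → ∀ x, M g x ≤ M h x)
    (hsmul : ∀ (c : ℝ≥0∞) (g : X → ℝ≥0∞) x, M (fun y => c * g y) x = c * M g x)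
    (hmeas : ∀ g, Measurable g → Measurable (M g))
    (H : ∀ g : X → ℝ≥0∞, Measurable g → ∫⁻ x, (g x) ^ p ∂μ < ⊤ → ∀ᵐ x ∂μ, M g x < ⊤) :
    ∃ δ : ℝ≥0∞, δ ≠ 0 ∧ δ ≠ ⊤ ∧ ∀ g : X → ℝ≥0∞, Measurable g → ∫⁻ x, (g x) ^ p ∂μ ≤ δ →
      μ {x | 1 < M g x} ≤ 2⁻¹ := by
  by_contra! hcon
  have hex : ∀ k : ℕ, ∃ g : X → ℝ≥0∞, Measurable g ∧
      ∫⁻ x, (g x) ^ p ∂μ ≤ (2⁻¹ : ℝ≥0∞) ^ k * (((2 : ℝ≥0∞) ^ k) ^ p)⁻¹ ∧ 2⁻¹ < μ {x | 1 < M g x} := by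
    intro k
    apply hcon
    · refine mul_ne_zero (by simp) (ENNReal.inv_ne_zero.2 (ENNReal.rpow_ne_top_of_nonneg hp.le (ENNReal.pow_ne_top ENNReal.ofNat_ne_top)))
    · refine ENNReal.mul_ne_top (by simp) (ENNReal.inv_ne_top.2 ?_)
      exact (ENNReal.rpow_pos (pos_iff_ne_zero.2 (pow_ne_zero k two_ne_zero)) (ENNReal.pow_ne_top ENNReal.ofNat_ne_top)).ne'
  choose g hgm hgi hgμ using hex
  set h : ℕ → X → ℝ≥0∞ := fun k x => (2:ℝ≥0∞)^k * g k x with hh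
  have hhm : ∀ k, Measurable (h k) := fun k => (hgm k).const_mul _
  have hint : ∀ k, ∫⁻ x, (h k x) ^ p ∂μ ≤ (2⁻¹ : ℝ≥0∞) ^ k := by
    intro k
    simp only [hh, ENNReal.mul_rpow_of_nonneg _ _ hp.le]
    rw [lintegral_const_mul _ ((hgm k).pow_const p)]
    refine (mul_le_mul_right (hgi k) _).trans ?_
    have h0 : ((2 : ℝ≥0∞) ^ k) ^ p ≠ 0 := (ENNReal.rpow_pos (pos_iff_ne_zero.2 (pow_ne_zero k two_ne_zero)) (ENNReal.pow_ne_top ENNReal.ofNat_ne_top)).ne'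
    have ht : ((2 : ℝ≥0∞) ^ k) ^ p ≠ ⊤ := ENNReal.rpow_ne_top_of_nonneg hp.le (by simp)
    rw [mul_comm, mul_assoc, ENNReal.inv_mul_cancel h0 ht, mul_one]
  set F : X → ℝ≥0∞ := fun x => ⨆ k, h k x with hF
  have hFm : Measurable F := Measurable.iSup hhm
  have hFi : ∫⁻ x, (F x) ^ p ∂μ < ⊤ := by
    refine (aux_sup hp h hhm).trans_lt ((ENNReal.tsum_le_tsum hint).trans_lt ?_)
    rw [ENNReal.tsum_geometric]
    simp
  have hae := H F hFm hFi
  set s : ℕ → Set X := fun k => {x | (2:ℝ≥0∞)^k < M F x} with hs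
  have hsm : ∀ k, MeasurableSet (s k) := fun k => measurableSet_lt measurable_const (hmeas F hFm)
  have hsμ : ∀ k, 2⁻¹ ≤ μ (s k) := by
    intro k
    refine (hgμ k).le.trans (measure_mono fun x hx => ?_)
    have h1 : M (h k) x ≤ M F x := hmono _ _ (fun y => le_iSup (fun k => h k y) k) x
    rw [hsmul] at h1
    refine lt_of_lt_of_le ?_ h1
    have hx' : 1 < M (g k) x := hx
    calc (2:ℝ≥0∞)^k = 2^k * 1 := by simp
      _ < _ := ENNReal.mul_lt_mul_right (by simp) (by simp) hx'
  have hanti : Antitone s := by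
    intro a b hab x hx
    exact lt_of_le_of_lt (pow_le_pow_right₀ (one_le_two (α := ℝ≥0∞)) hab) hx
  have hlim := tendsto_measure_iInter_atTop (μ := μ) (fun i => (hsm i).nullMeasurableSet) hanti
    ⟨0, measure_ne_top _ _⟩
  have h1 : 2⁻¹ ≤ μ (⋂ n, s n) := ge_of_tendsto' hlim hsμ
  have h2 : μ (⋂ n, s n) = 0 := by
    refine measure_mono_null ?_ hae
    intro x hx hlt
    have hx2 : ∀ k : ℕ, (2:ℝ≥0∞)^k < M F x := fun k => mem_iInter.1 hx k
    have ht : Tendsto (fun k : ℕ => (2:ℝ≥0∞)^k) atTop (𝓝 ⊤) :=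
      ENNReal.tendsto_pow_atTop_nhds_top_iff.2 (by norm_num)
    have := le_of_tendsto' ht fun k => (hx2 k).le
    exact absurd hlt (not_lt.2 this)
  rw [h2] at h1
  simp at h1

theorem aux_abstract {X : Type*} [MeasurableSpace X] {μ : Measure X} [IsProbabilityMeasure μ]
    {S : X → X} (hS : Ergodic S μ) {M : (X → ℝ≥0∞) → X → ℝ≥0∞} {p : ℝ} (hp : 0 < p)
    (hmono : ∀ g h : X → ℝ≥0∞, (∀ x, g x ≤ h x) → ∀ x, M g x ≤ M h x)
    (hsmul : ∀ (c : ℝ≥0∞) (g : X → ℝ≥0∞) x, M (fun y => c * g y) x = c * M g x)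
    (hmeas : ∀ g, Measurable g → Measurable (M g))
    (hcomm : ∀ g x, M (fun y => g (S y)) x = M g (S x))
    (H : ∀ g : X → ℝ≥0∞, Measurable g → ∫⁻ x, (g x) ^ p ∂μ < ⊤ → ∀ᵐ x ∂μ, M g x < ⊤) :
    ∃ C : ℝ, 0 < C ∧ ∀ g : X → ℝ≥0∞, Measurable g →
      μ {x | 1 < M g x} ≤ ENNReal.ofReal C * ∫⁻ x, (g x) ^ p ∂μ := by
  obtain ⟨δ, hδ0, hδt, hδ⟩ := aux_step1 hp hmono hsmul hmeas H
  have hδr : 0 < δ.toReal := ENNReal.toReal_pos hδ0 hδt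
  refine ⟨3 / δ.toReal, by positivity, fun g hg => ?_⟩
  set E := {x | 1 < M g x} with hE
  have hEm : MeasurableSet E := measurableSet_lt measurable_const (hmeas g hg)
  set I := ∫⁻ x, (g x) ^ p ∂μ with hI
  by_cases hIt : I = ⊤
  · rw [hIt, ENNReal.mul_top (by simp; positivity)]
    exact le_top
  by_cases he0 : μ E = 0
  · rw [he0]; exact zero_le
  set e := μ.real E with he
  have hepos : 0 < e := ENNReal.toReal_pos he0 (measure_ne_top _ _)
  have he1 : e ≤ 1 := measureReal_le_one
  set N := ⌈2 / e⌉₊ with hN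
  have hN1 : 2 / e ≤ N := Nat.le_ceil _
  have hN2 : (N:ℝ) ≤ 3 / e := by
    have := (Nat.ceil_lt_add_one (a := 2 / e) (by positivity)).le
    refine this.trans ?_
    rw [div_add_one hepos.ne']
    gcongr
    linarith
  obtain ⟨m, hm⟩ := aux_cover hS hEm N
  have hMP := fun k => hS.toMeasurePreserving.iterate k
  set V := ⋃ i ∈ Finset.range N, S^[m i] ⁻¹' E with hV
  have hVm : MeasurableSet V :=
    Finset.measurableSet_biUnion _ fun i _ => (hMP (m i)).measurable hEm
  have hVbig : 2⁻¹ < μ V := by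
    have h1 : (1 - e/2)^N < 1/2 := by
      calc (1 - e/2)^N ≤ (Real.exp (-(e/2)))^N := by
            gcongr
            · linarith
            · have := Real.add_one_le_exp (-(e/2)); linarith
        _ = Real.exp (-(e/2*N)) := by rw [← Real.exp_nat_mul]; ring_nf
        _ ≤ Real.exp (-1) := by
            apply Real.exp_le_exp.2
            rw [div_le_iff₀ hepos] at hN1
            linarith
        _ < 1/2 := by
            have := Real.exp_neg_one_lt_d9
            linarith
    have h2 := probReal_compl_eq_one_sub (μ := μ) hVm
    have h3 : (2:ℝ)⁻¹ < μ.real V := by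
      rw [h2] at hm
      norm_num at h1 ⊢
      linarith
    rw [← ENNReal.toReal_lt_toReal (by simp) (measure_ne_top _ _)]
    simpa [Measure.real] using h3
  set F : X → ℝ≥0∞ := fun x => ⨆ i : Fin N, g (S^[m i] x) with hF
  have hgm : ∀ i : Fin N, Measurable fun x => g (S^[m i] x) := fun i => hg.comp (hMP _).measurable
  have hFm : Measurable F := Measurable.iSup hgm
  have hFi : ∫⁻ x, (F x) ^ p ∂μ ≤ N * I := by
    refine (aux_sup hp _ hgm).trans ?_
    have : ∀ i : Fin N, ∫⁻ x, (g (S^[m i] x)) ^ p ∂μ = I := fun i =>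
      (hMP (m i)).lintegral_comp (f := fun x => g x ^ p) (hg.pow_const p)
    simp [this]
  have hsub : V ⊆ {x | 1 < M F x} := by
    intro x hx
    simp only [hV, mem_iUnion, Finset.mem_range] at hx
    obtain ⟨i, hi, hx⟩ := hx
    have hx' : 1 < M g (S^[m i] x) := hx
    rw [← aux_comm hcomm] at hx'
    exact lt_of_lt_of_le hx' (hmono _ _ (fun y => le_iSup (fun i : Fin N => g (S^[m i] y)) ⟨i, hi⟩) x)
  have hlt : δ < N * I := by
    by_contra! hle
    have := hδ F hFm (hFi.trans hle)
    exact absurd (hVbig.trans_le ((measure_mono hsub).trans this)) (lt_irrefl _)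
  have hr : δ.toReal < N * I.toReal := by
    have := (ENNReal.toReal_lt_toReal hδt (ENNReal.mul_ne_top (by simp) hIt)).2 hlt
    simpa using this
  have hfin : e ≤ 3 / δ.toReal * I.toReal := by
    have : δ.toReal < 3 / e * I.toReal := hr.trans_le (by gcongr)
    rw [div_mul_eq_mul_div, lt_div_iff₀ hepos] at this
    rw [div_mul_eq_mul_div, le_div_iff₀ hδr]
    linarith
  rw [← ENNReal.ofReal_toReal (measure_ne_top μ E), ← ENNReal.ofReal_toReal hIt,
    ← ENNReal.ofReal_mul (by positivity)]
  exact ENNReal.ofReal_le_ofReal hfin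

open Classical in
def latF (R : Rect) : Finset (ℤ × ℤ) :=
  if h : (latticePts R.carrier).Finite then h.toFinset else ∅

theorem aux_ergAvg {X : Type*} [MeasurableSpace X] (S T : X ≃ᵐ X) (R : Rect) (f : X → ℝ) (x : X) :
    ergAvg S T R f x = ((latF R).card : ℝ)⁻¹ *
      ∑ p ∈ latF R, f ((S.toEquiv ^ p.1) ((T.toEquiv ^ p.2) x)) := by
  unfold ergAvg latF latticeCount
  by_cases h : (latticePts R.carrier).Finite
  · rw [dif_pos h, Set.ncard_eq_toFinset_card _ h, finsum_mem_eq_finite_toFinset_sum _ h]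
  · rw [dif_neg h, Set.Infinite.ncard h]
    simp

def EM {X : Type*} [MeasurableSpace X] (S T : X ≃ᵐ X) (R : ℕ → Rect) (g : X → ℝ≥0∞) (x : X) : ℝ≥0∞ :=
  ⨆ n, ((latF (R n)).card : ℝ≥0∞)⁻¹ *
      ∑ p ∈ latF (R n), g ((S.toEquiv ^ p.1) ((T.toEquiv ^ p.2) x))

theorem aux_mp {X : Type*} [MeasurableSpace X] {μ : Measure X} (S : X ≃ᵐ X)
    (hS : MeasurePreserving (⇑S) μ μ) (k : ℤ) : MeasurePreserving (⇑(S.toEquiv ^ k)) μ μ := by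
  have hnat : ∀ n : ℕ, ∀ U : X ≃ᵐ X, MeasurePreserving (⇑U) μ μ →
      MeasurePreserving (⇑(U.toEquiv ^ n)) μ μ := by
    intro n U hU
    have : ⇑(U.toEquiv ^ n) = (⇑U)^[n] := by
      rw [Equiv.Perm.coe_pow]; rfl
    rw [this]
    exact hU.iterate n
  cases k with
  | ofNat n => simpa using hnat n S hS
  | negSucc n =>
    have h := hnat (n+1) S.symm (hS.symm S)
    have h2 : S.toEquiv ^ Int.negSucc n = S.symm.toEquiv ^ (n+1) := by
      rw [zpow_negSucc, ← inv_pow]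
      rfl
    rw [h2]
    exact h

theorem aux_avg_le (F : Finset (ℤ × ℤ)) (u : ℤ × ℤ → ℝ) :
    ENNReal.ofReal |(F.card : ℝ)⁻¹ * ∑ q ∈ F, u q| ≤ (F.card : ℝ≥0∞)⁻¹ * ∑ q ∈ F, ‖u q‖ₑ := by
  rcases F.eq_empty_or_nonempty with rfl | hF
  · simp
  have hc : (0:ℝ) < F.card := by exact_mod_cast hF.card_pos
  rw [abs_mul, ENNReal.ofReal_mul (abs_nonneg _), abs_of_pos (inv_pos.2 hc), ENNReal.ofReal_inv_of_pos hc,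
    ENNReal.ofReal_natCast]
  gcongr
  rw [← Real.enorm_eq_ofReal_abs]
  exact enorm_sum_le _ _

theorem aux_avg_eq (F : Finset (ℤ × ℤ)) (u : ℤ × ℤ → ℝ≥0∞) (hu : ∀ q, u q ≠ ⊤) :
    (F.card : ℝ≥0∞)⁻¹ * ∑ q ∈ F, u q = ENNReal.ofReal |(F.card : ℝ)⁻¹ * ∑ q ∈ F, (u q).toReal| := by
  rcases F.eq_empty_or_nonempty with rfl | hF
  · simp
  have hc : (0:ℝ) < F.card := by exact_mod_cast hF.card_pos
  have hs : 0 ≤ ∑ q ∈ F, (u q).toReal := Finset.sum_nonneg fun _ _ => ENNReal.toReal_nonneg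
  rw [abs_of_nonneg (by positivity), ENNReal.ofReal_mul (by positivity), ENNReal.ofReal_inv_of_pos hc,
    ENNReal.ofReal_natCast, ENNReal.ofReal_sum_of_nonneg fun _ _ => ENNReal.toReal_nonneg]
  congr 1
  exact Finset.sum_congr rfl fun q _ => (ENNReal.ofReal_toReal (hu q)).symm

theorem aux_EM {X : Type*} [MeasurableSpace X] (μ : Measure X) (S T : X ≃ᵐ X)
    (hsetup : ErgodicSetup μ S T) (R : ℕ → Rect) (p : ℝ) (hp : 1 ≤ p)
    (H : ∀ g : X → ℝ≥0∞, Measurable g → ∫⁻ x, (g x) ^ p ∂μ < ⊤ → ∀ᵐ x ∂μ, EM S T R g x < ⊤) :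
    ∃ C : ℝ, 0 < C ∧ ∀ g : X → ℝ≥0∞, Measurable g →
      μ {x | 1 < EM S T R g x} ≤ ENNReal.ofReal C * ∫⁻ x, (g x) ^ p ∂μ := by
  have := hsetup.prob
  refine aux_abstract hsetup.erg_S (by linarith) ?_ ?_ ?_ ?_ H
  · intro g h hgh x
    unfold EM
    gcongr
    exact hgh _
  · intro c g x
    unfold EM
    rw [ENNReal.mul_iSup]
    refine iSup_congr fun n => ?_
    rw [← Finset.mul_sum, mul_left_comm]
  · intro g hg
    refine Measurable.iSup fun n => Measurable.const_mul (Finset.measurable_sum _ fun q _ => ?_) _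
    exact hg.comp ((aux_mp S hsetup.measPres_S q.1).measurable.comp (aux_mp T hsetup.measPres_T q.2).measurable)
  · intro g x
    unfold EM
    have hc : Commute S.toEquiv T.toEquiv := by
      ext y
      exact hsetup.comm y
    refine iSup_congr fun n => ?_
    congr 1
    refine Finset.sum_congr rfl fun q _ => ?_
    have h1 : S.toEquiv * (S.toEquiv ^ q.1 * T.toEquiv ^ q.2) = (S.toEquiv ^ q.1 * T.toEquiv ^ q.2) * S.toEquiv :=
      ((Commute.refl _).zpow_right _).mul_right (hc.zpow_right _)
    exact congrArg g (DFunLike.congr_fun h1 x)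

theorem aux_ae {X : Type*} [MeasurableSpace X] {μ : Measure X} {S T : X ≃ᵐ X}
    (hsetup : ErgodicSetup μ S T) {P : X → Prop} (h : ∀ᵐ x ∂μ, P x) :
    ∀ᵐ x ∂μ, ∀ q : ℤ × ℤ, P ((S.toEquiv ^ q.1) ((T.toEquiv ^ q.2) x)) := by
  rw [ae_all_iff]
  intro q
  exact ((aux_mp S hsetup.measPres_S q.1).comp
    (aux_mp T hsetup.measPres_T q.2)).quasiMeasurePreserving.ae h

/-- continuity principle: `M* f < ∞` a.e. for every `f ∈ L^p` iff
`M*` is of weak-type `(p,p)` (here `M* f = sup_n |M_n f|`). -/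
theorem stmt13 {X : Type*} [MeasurableSpace X] (μ : Measure X) (S T : X ≃ᵐ X)
    (hsetup : ErgodicSetup μ S T) (R : ℕ → Rect) (hR : IsProcess R)
    (p : ℝ) (hp : 1 ≤ p) :
    (∀ f : X → ℝ, MemLp f (ENNReal.ofReal p) μ →
        ∀ᵐ x ∂μ, maxOpAbs S T R f x < ⊤) ↔
      IsWeakType μ (maxOpAbs S T R) p := by
  have hp0 : 0 < p := by linarith
  have hpt : (ENNReal.ofReal p).toReal = p := ENNReal.toReal_ofReal hp0.le
  have hpn0 : ENNReal.ofReal p ≠ 0 := by simpa using hp0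
  have := hsetup.prob
  constructor
  · intro h
    obtain ⟨C, hC, hw⟩ := aux_EM μ S T hsetup R p hp (by
      intro g hg hgi
      have hfin : ∀ᵐ x ∂μ, g x ≠ ⊤ := by
        filter_upwards [ae_lt_top (hg.pow_const p) hgi.ne] with x hx
        intro hgx
        rw [hgx, ENNReal.top_rpow_of_pos hp0] at hx
        exact lt_irrefl _ hx
      have hmem : MemLp (fun x => (g x).toReal) (ENNReal.ofReal p) μ := by
        refine ⟨hg.ennreal_toReal.aestronglyMeasurable, ?_⟩
        rw [eLpNorm_lt_top_iff_lintegral_rpow_enorm_lt_top hpn0 ENNReal.ofReal_ne_top, hpt]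
        refine lt_of_le_of_lt (lintegral_mono fun x => ?_) hgi
        refine ENNReal.rpow_le_rpow ?_ hp0.le
        rw [Real.enorm_eq_ofReal ENNReal.toReal_nonneg]
        exact ENNReal.ofReal_toReal_le
      filter_upwards [h _ hmem, aux_ae hsetup hfin] with x hx hx2
      refine lt_of_eq_of_lt ?_ hx
      unfold EM maxOpAbs
      refine iSup_congr fun n => ?_
      rw [aux_ergAvg]
      exact aux_avg_eq _ (fun q => g ((S.toEquiv ^ q.1) ((T.toEquiv ^ q.2) x))) hx2)
    refine ⟨C, hC, fun f hf lam hlam => ?_⟩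
    set f' := hf.1.mk f with hf'
    have hff' : f =ᵐ[μ] f' := hf.1.ae_eq_mk
    have hf'm : Measurable f' := hf.1.stronglyMeasurable_mk.measurable
    set l := ENNReal.ofReal lam with hl
    have hl0 : l ≠ 0 := by simpa [hl] using hlam
    have hlt : l ≠ ⊤ := ENNReal.ofReal_ne_top
    set g : X → ℝ≥0∞ := fun x => ‖f' x‖ₑ with hg
    have hgm : Measurable g := hf'm.enorm
    have hEM : ∀ᵐ x ∂μ, l < maxOpAbs S T R f x → 1 < EM S T R (fun x => l⁻¹ * g x) x := by
      filter_upwards [aux_ae hsetup hff'] with x hx hlx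
      unfold maxOpAbs at hlx
      obtain ⟨n, hn⟩ := lt_iSup_iff.1 hlx
      rw [aux_ergAvg] at hn
      have h2 := hn.trans_le (aux_avg_le (latF (R n)) (fun q => f ((S.toEquiv ^ q.1) ((T.toEquiv ^ q.2) x))))
      refine lt_of_lt_of_le ?_ (le_iSup _ n)
      simp only [hx] at h2
      rw [← Finset.mul_sum, mul_left_comm, ← ENNReal.inv_mul_cancel hl0 hlt]
      exact ENNReal.mul_lt_mul_right (ENNReal.inv_ne_zero.2 hlt) (ENNReal.inv_ne_top.2 hl0) h2
    have hle : μ {x | l < maxOpAbs S T R f x} ≤ μ {x | 1 < EM S T R (fun x => l⁻¹ * g x) x} :=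
      measure_mono_ae hEM
    refine hle.trans ((hw _ (hgm.const_mul _)).trans ?_)
    rw [ENNReal.ofReal_mul hC.le]
    gcongr
    have h1 : ∫⁻ x, (l⁻¹ * g x) ^ p ∂μ = (l⁻¹) ^ p * (eLpNorm f (ENNReal.ofReal p) μ) ^ p := by
      simp only [ENNReal.mul_rpow_of_nonneg _ _ hp0.le]
      rw [lintegral_const_mul _ (hgm.pow_const p), eLpNorm_congr_ae hff',
        eLpNorm_eq_lintegral_rpow_enorm_toReal hpn0 ENNReal.ofReal_ne_top, hpt, ← ENNReal.rpow_mul,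
        one_div, inv_mul_cancel₀ hp0.ne', ENNReal.rpow_one]
    rw [h1, ← ENNReal.mul_rpow_of_nonneg _ _ hp0.le, ← ENNReal.ofReal_rpow_of_nonneg (by positivity) hp0.le,
      ENNReal.ofReal_div_of_pos hlam, ENNReal.ofReal_toReal hf.2.ne, mul_comm, ENNReal.div_eq_inv_mul, mul_comm]
  · rintro ⟨C, hC, hw⟩ f hf
    have hlim : Tendsto (fun n : ℕ => ENNReal.ofReal
        (C * ((eLpNorm f (ENNReal.ofReal p) μ).toReal / ((n:ℝ)+1)) ^ p)) atTop (𝓝 0) := by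
      have h1 : Tendsto (fun n : ℕ => (eLpNorm f (ENNReal.ofReal p) μ).toReal / ((n:ℝ)+1)) atTop (𝓝 0) :=
        tendsto_const_nhds.div_atTop (tendsto_atTop_add_const_right _ _ tendsto_natCast_atTop_atTop)
      have h2 := (h1.rpow_const (p := p) (Or.inr hp0.le)).const_mul C
      rw [Real.zero_rpow hp0.ne', mul_zero] at h2
      simpa using ENNReal.tendsto_ofReal h2
    have hz : μ {x | ¬ maxOpAbs S T R f x < ⊤} ≤ 0 := by
      refine ge_of_tendsto' hlim fun n => (measure_mono fun x hx => ?_).trans (hw f hf ((n:ℝ)+1) (by positivity))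
      have hx' : maxOpAbs S T R f x = ⊤ := by simpa using hx
      show ENNReal.ofReal ((n:ℝ)+1) < maxOpAbs S T R f x
      rw [hx']
      exact ENNReal.ofReal_lt_top
    exact nonpos_iff_eq_zero.1 hz

end
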